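/- arXiv:1307.0998 — 5 statements merged into one kernel-verified Lean document; each statement's English description precedes it below -/
import Mathlib

section
/- (Extended Desargues theorem, algebraic form.) Let n ≥ 2, let x₁, …, x_{n+1} be a basis of ℝ^{n+1}, let y₁, …, y_{n+1} ∈ ℝ^{n+1}, and let s ∈ ℝ^{n+1} be nonzero such that for every index i there are scalars λᵢ ≠ 0 and λ'ᵢ ≠ 0 with s = λᵢ·xᵢ + λ'ᵢ·yᵢ (i.e., s is collinear with xᵢ and yᵢ and distinct from both). For i ≠ j define s_{ij} = λᵢ·xᵢ − λⱼ·xⱼ. Then (1) s_{ij} = λ'ⱼ·yⱼ − λ'ᵢ·yᵢ, so s_{ij} lies both in span{xᵢ, xⱼ} and in span{yᵢ, yⱼ}; and (2) the linear span of the set {s_{ij} : 1 ≤ i < j ≤ n+1} has dimension exactly n. -/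
open Matrix

/-- The direction of the affine span of a family indexed by a linear order is spanned by the
differences `p i - p j` with `i < j`. -/
theorem span_sub_of_lt_eq_vectorSpan {ι R M : Type*} [LinearOrder ι] [Ring R] [AddCommGroup M]
    [Module R M] (p : ι → M) :
    Submodule.span R {v | ∃ i j, i < j ∧ v = p i - p j} = vectorSpan R (Set.range p) := by
  apply le_antisymm
  · rw [Submodule.span_le]
    rintro _ ⟨i, j, -, rfl⟩
    exact vsub_mem_vectorSpan R (Set.mem_range_self i) (Set.mem_range_self j)
  · rw [vectorSpan_def, Submodule.span_le]
    rintro _ ⟨_, ⟨i, rfl⟩, _, ⟨j, rfl⟩, rfl⟩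
    rcases lt_trichotomy i j with h | rfl | h
    · exact Submodule.subset_span ⟨i, j, h, rfl⟩
    · simp
    · change p i - p j ∈ _
      rw [← neg_sub]
      exact Submodule.neg_mem _ (Submodule.subset_span ⟨j, i, h, rfl⟩)

/-- A difference of scalar multiples of `u` and `v` lies in their span. -/
theorem smul_sub_smul_mem_span_pair {R M : Type*} [Ring R] [AddCommGroup M] [Module R M]
    (a b : R) (u v : M) : a • u - b • v ∈ Submodule.span R {u, v} :=
  Submodule.sub_mem _ (Submodule.smul_mem _ _ (Submodule.mem_span_of_mem (by simp)))
    (Submodule.smul_mem _ _ (Submodule.mem_span_of_mem (by simp)))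


/-- Extended Desargues theorem, algebraic form. -/
theorem stmt_2 (n : ℕ) (hn : 2 ≤ n)
    (x y : Fin (n + 1) → (Fin (n + 1) → ℝ))
    (hx : LinearIndependent ℝ x)
    (s : Fin (n + 1) → ℝ) (hs : s ≠ 0)
    (lam lam' : Fin (n + 1) → ℝ)
    (hlam : ∀ i, lam i ≠ 0) (hlam' : ∀ i, lam' i ≠ 0)
    (hcol : ∀ i, s = lam i • x i + lam' i • y i) :
    (∀ i j, i ≠ j →
      lam i • x i - lam j • x j = lam' j • y j - lam' i • y i ∧
      lam i • x i - lam j • x j ∈ Submodule.span ℝ {x i, x j} ∧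
      lam i • x i - lam j • x j ∈ Submodule.span ℝ {y i, y j}) ∧
    Module.finrank ℝ (Submodule.span ℝ
      {v : Fin (n + 1) → ℝ |
        ∃ i j : Fin (n + 1), i < j ∧ v = lam i • x i - lam j • x j}) = n := by
  constructor
  · intro i j _
    have h : lam i • x i - lam j • x j = lam' j • y j - lam' i • y i := by
      rw [sub_eq_sub_iff_add_eq_add, ← hcol i, add_comm (lam' j • y j), ← hcol j]
    refine ⟨h, smul_sub_smul_mem_span_pair _ _ _ _, ?_⟩
    rw [h, Set.pair_comm]
    exact smul_sub_smul_mem_span_pair _ _ _ _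
  · have hind : LinearIndependent ℝ fun i => lam i • x i :=
      hx.units_smul fun i => Units.mk0 (lam i) (hlam i)
    rw [span_sub_of_lt_eq_vectorSpan fun i => lam i • x i]
    exact hind.affineIndependent.finrank_vectorSpan (by simp)
end

section
/- (Two involution theorem 1.) Let n ≥ 1, let π ∈ ℝ^{n+1} be nonzero, and let s₁, s₂ ∈ ℝ^{n+1} satisfy πᵀ·s₁ ≠ 0 and πᵀ·s₂ ≠ 0. Define Tₖ = I − (2/(πᵀ·sₖ))·sₖ·πᵀ for k = 1, 2, and s₃ = 2·(s₁/(πᵀ·s₁) − s₂/(πᵀ·s₂)). Then T₁·T₂ = I + s₃·πᵀ, where πᵀ·s₃ = 0 and s₃ ∈ span{s₁, s₂}; thus T₁·T₂ is an elementary perspective with hyperplane π whose center s₃ lies on π and on the line joining s₁ and s₂. Moreover (T₁·T₂)·(T₂·T₁) = I, so T₁·T₂ and T₂·T₁ are inverse to each other. -/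
open Matrix

/-- The product of two stereohomologies with a common hyperplane. -/
lemma stereohomology_mul_stereohomology {ι : Type*} [Fintype ι] [DecidableEq ι]
    (π s t : ι → ℝ) (hs : π ⬝ᵥ s ≠ 0) (ht : π ⬝ᵥ t ≠ 0) :
    (1 - (2 / (π ⬝ᵥ s)) • vecMulVec s π) * (1 - (2 / (π ⬝ᵥ t)) • vecMulVec t π) =
      1 + vecMulVec ((2 : ℝ) • ((π ⬝ᵥ s)⁻¹ • s - (π ⬝ᵥ t)⁻¹ • t)) π := by
  have hmul : vecMulVec s π * vecMulVec t π = (π ⬝ᵥ t) • vecMulVec s π := by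
    rw [vecMulVec_mul_vecMulVec, vecMulVec_smul]
  rw [sub_mul, mul_sub, mul_sub, smul_mul_smul_comm, hmul]
  ext i j
  simp only [one_mul, mul_one, Matrix.sub_apply, Matrix.add_apply, Matrix.smul_apply,
    vecMulVec_apply, Pi.smul_apply, Pi.sub_apply, smul_eq_mul]
  field_simp
  ring

/-- A stereohomology is an involution. -/
lemma stereohomology_mul_self {ι : Type*} [Fintype ι] [DecidableEq ι]
    (π s : ι → ℝ) (hs : π ⬝ᵥ s ≠ 0) :
    (1 - (2 / (π ⬝ᵥ s)) • vecMulVec s π) * (1 - (2 / (π ⬝ᵥ s)) • vecMulVec s π) = 1 := by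
  simp [stereohomology_mul_stereohomology π s s hs hs]

/-- Two involution theorem 1: common hyperplane. -/
theorem stmt_13 (n : ℕ) (hn : 1 ≤ n)
    (π s₁ s₂ : Fin (n + 1) → ℝ) (hπ : π ≠ 0)
    (h1 : π ⬝ᵥ s₁ ≠ 0) (h2 : π ⬝ᵥ s₂ ≠ 0)
    (T₁ T₂ : Matrix (Fin (n + 1)) (Fin (n + 1)) ℝ)
    (hT₁ : T₁ = 1 - (2 / (π ⬝ᵥ s₁)) • Matrix.vecMulVec s₁ π)
    (hT₂ : T₂ = 1 - (2 / (π ⬝ᵥ s₂)) • Matrix.vecMulVec s₂ π)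
    (s₃ : Fin (n + 1) → ℝ)
    (hs₃ : s₃ = (2 : ℝ) • ((π ⬝ᵥ s₁)⁻¹ • s₁ - (π ⬝ᵥ s₂)⁻¹ • s₂)) :
    T₁ * T₂ = 1 + Matrix.vecMulVec s₃ π ∧
    π ⬝ᵥ s₃ = 0 ∧
    s₃ ∈ Submodule.span ℝ {s₁, s₂} ∧
    (T₁ * T₂) * (T₂ * T₁) = 1 := by
  subst hT₁ hT₂ hs₃
  refine ⟨stereohomology_mul_stereohomology π s₁ s₂ h1 h2, ?_, ?_, ?_⟩
  · simp [dotProduct_smul, dotProduct_sub, h1, h2]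
  · have hmem₁ : s₁ ∈ Submodule.span ℝ {s₁, s₂} := Submodule.subset_span (by simp)
    have hmem₂ : s₂ ∈ Submodule.span ℝ {s₁, s₂} := Submodule.subset_span (by simp)
    exact Submodule.smul_mem _ _
      (Submodule.sub_mem _ (Submodule.smul_mem _ _ hmem₁) (Submodule.smul_mem _ _ hmem₂))
  · rw [mul_assoc, ← mul_assoc _ _ (1 - (2 / (π ⬝ᵥ s₁)) • vecMulVec s₁ π),
      stereohomology_mul_self π s₂ h2, one_mul, stereohomology_mul_self π s₁ h1]
end

section
/- (Two involution theorem 2.) Let n ≥ 1, let s ∈ ℝ^{n+1} be nonzero, and let π₁, π₂ ∈ ℝ^{n+1} satisfy π₁ᵀ·s ≠ 0 and π₂ᵀ·s ≠ 0. Define Tₖ = I − (2/(πₖᵀ·s))·s·πₖᵀ for k = 1, 2, and π₃ = 2·(π₂/(π₂ᵀ·s) − π₁/(π₁ᵀ·s)). Then T₁·T₂ = I + s·π₃ᵀ, where π₃ᵀ·s = 0 and π₃ ∈ span{π₁, π₂}; thus T₁·T₂ is an elementary perspective with center s whose hyperplane π₃ passes through s and lies in the pencil determined by π₁ and π₂.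 Moreover (T₁·T₂)·(T₂·T₁) = I, so T₁·T₂ and T₂·T₁ are inverse to each other. -/
open Matrix

/-- The product of two involutory stereohomologies with common center `s`, whose hyperplanes `p`, `q`
are scaled so that `p ⬝ᵥ s = 2`. -/
theorem one_sub_vecMulVec_mul_one_sub_vecMulVec {ι R : Type*} [Fintype ι] [DecidableEq ι]
    [CommRing R] (s p q : ι → R) (hp : p ⬝ᵥ s = 2) :
    (1 - vecMulVec s p) * (1 - vecMulVec s q) = 1 + vecMulVec s (q - p) := by
  rw [sub_mul, mul_sub, mul_sub, vecMulVec_mul_vecMulVec, hp, two_smul, vecMulVec_add,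
    vecMulVec_sub]
  simp only [one_mul, mul_one]
  abel

/-- A stereohomology with `p ⬝ᵥ s = 2` is an involution. -/
theorem one_sub_vecMulVec_mul_self {ι R : Type*} [Fintype ι] [DecidableEq ι]
    [CommRing R] (s p : ι → R) (hp : p ⬝ᵥ s = 2) :
    (1 - vecMulVec s p) * (1 - vecMulVec s p) = 1 := by
  simp [one_sub_vecMulVec_mul_one_sub_vecMulVec s p p hp]

/-- Two involution theorem 2: common center. -/
theorem stmt_14 (n : ℕ) (hn : 1 ≤ n)
    (s π₁ π₂ : Fin (n + 1) → ℝ) (hs : s ≠ 0)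
    (h1 : π₁ ⬝ᵥ s ≠ 0) (h2 : π₂ ⬝ᵥ s ≠ 0)
    (T₁ T₂ : Matrix (Fin (n + 1)) (Fin (n + 1)) ℝ)
    (hT₁ : T₁ = 1 - (2 / (π₁ ⬝ᵥ s)) • Matrix.vecMulVec s π₁)
    (hT₂ : T₂ = 1 - (2 / (π₂ ⬝ᵥ s)) • Matrix.vecMulVec s π₂)
    (π₃ : Fin (n + 1) → ℝ)
    (hπ₃ : π₃ = (2 : ℝ) • ((π₂ ⬝ᵥ s)⁻¹ • π₂ - (π₁ ⬝ᵥ s)⁻¹ • π₁)) :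
    T₁ * T₂ = 1 + Matrix.vecMulVec s π₃ ∧
    π₃ ⬝ᵥ s = 0 ∧
    π₃ ∈ Submodule.span ℝ {π₁, π₂} ∧
    (T₁ * T₂) * (T₂ * T₁) = 1 := by
  rw [← vecMulVec_smul] at hT₁ hT₂
  have hp₁ : ((2 / (π₁ ⬝ᵥ s)) • π₁) ⬝ᵥ s = 2 := by
    rw [smul_dotProduct, smul_eq_mul, div_mul_cancel₀ _ h1]
  have hp₂ : ((2 / (π₂ ⬝ᵥ s)) • π₂) ⬝ᵥ s = 2 := by
    rw [smul_dotProduct, smul_eq_mul, div_mul_cancel₀ _ h2]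
  have hdiff : π₃ = (2 / (π₂ ⬝ᵥ s)) • π₂ - (2 / (π₁ ⬝ᵥ s)) • π₁ := by
    rw [hπ₃, smul_sub, smul_smul, smul_smul, ← div_eq_mul_inv, ← div_eq_mul_inv]
  refine ⟨?_, ?_, ?_, ?_⟩
  · rw [hT₁, hT₂, hdiff, one_sub_vecMulVec_mul_one_sub_vecMulVec _ _ _ hp₁]
  · rw [hdiff, sub_dotProduct, hp₁, hp₂, sub_self]
  · rw [hdiff]
    exact Submodule.sub_mem _
      (Submodule.smul_mem _ _ (Submodule.subset_span (by simp)))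
      (Submodule.smul_mem _ _ (Submodule.subset_span (by simp)))
  · have hinv₁ : T₁ * T₁ = 1 := hT₁ ▸ one_sub_vecMulVec_mul_self _ _ hp₁
    have hinv₂ : T₂ * T₂ = 1 := hT₂ ▸ one_sub_vecMulVec_mul_self _ _ hp₂
    rw [mul_assoc, ← mul_assoc T₂, hinv₂, one_mul, hinv₁]
end

section
/- Let n ≥ 1, let T be an invertible real (n+1)×(n+1) matrix, let (x₁, …, x_{n+1}) be a basis of ℝ^{n+1}, let y₁, …, y_{n+1} ∈ ℝ^{n+1} and ρ₁, …, ρ_{n+1} be nonzero scalars with T·xᵢ = ρᵢ·yᵢ for all i, and let s ∈ ℝ^{n+1} and ρ_s ≠ 0 satisfy T·s = ρ_s·s. Suppose s = Σᵢ μᵢ·xᵢ with all μᵢ ≠ 0, and that for every i there are scalars λᵢ ≠ 0 and λ'ᵢ ≠ 0 with s = λᵢ·xᵢ + λ'ᵢ·yᵢ. Then the quantity ρᵢ·λᵢ/λ'ᵢ is independent of i, i.e., ρᵢ·λᵢ/λ'ᵢ = ρ₁·λ₁/λ'₁ for all i. -/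
open Matrix

/-- If a linear map `f` sends each member `x i` of a linearly independent family to
`c i • s - k i • x i`, and `s = ∑ i, μ i • x i` with all `μ i ≠ 0` is an eigenvector of `f`
for `a`, then every `k i` equals `(∑ j, μ j * c j) - a`. -/
theorem LinearIndependent.eq_sum_sub_of_map_eq_smul_sub_smul {ι K V : Type*} [Fintype ι]
    [Field K] [AddCommGroup V] [Module K V] (f : V →ₗ[K] V) {x : ι → V}
    (hx : LinearIndependent K x) {s : V} {a : K} (hs : f s = a • s) {μ c k : ι → K}
    (hμ : ∀ i, μ i ≠ 0) (hsum : s = ∑ i, μ i • x i)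
    (hf : ∀ i, f (x i) = c i • s - k i • x i) (i : ι) :
    k i = (∑ j, μ j * c j) - a := by
  have hfs : f s = (∑ j, μ j * c j) • s - ∑ j, (μ j * k j) • x j := by
    conv_lhs => rw [hsum]
    simp only [map_sum, map_smul, hf, smul_sub, smul_smul, Finset.sum_sub_distrib,
      Finset.sum_smul]
  have hzero : ∑ j, (μ j * ((∑ l, μ l * c l) - a - k j)) • x j = 0 := by
    have hexpand : ∑ j, (μ j * ((∑ l, μ l * c l) - a - k j)) • x j =
        ((∑ l, μ l * c l) - a) • s - ∑ j, (μ j * k j) • x j := by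
      conv_rhs => rw [hsum]
      rw [Finset.smul_sum, ← Finset.sum_sub_distrib]
      refine Finset.sum_congr rfl fun j _ => ?_
      module
    rw [hexpand, sub_smul, ← hs, hfs]
    abel
  have hi := Fintype.linearIndependent_iff.mp hx _ hzero i
  exact (sub_eq_zero.mp ((mul_eq_zero.mp hi).resolve_left (hμ i))).symm

/-- in an extended Desarguesian configuration the ratio
`ρᵢ·λᵢ/λ'ᵢ` is independent of `i`. -/
theorem stmt_16 (n : ℕ) (hn : 1 ≤ n)
    (T : Matrix (Fin (n + 1)) (Fin (n + 1)) ℝ) (hT : IsUnit T.det)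
    (x y : Fin (n + 1) → (Fin (n + 1) → ℝ)) (hx : LinearIndependent ℝ x)
    (ρ : Fin (n + 1) → ℝ) (hρ : ∀ i, ρ i ≠ 0)
    (hTx : ∀ i, T.mulVec (x i) = ρ i • y i)
    (s : Fin (n + 1) → ℝ) (ρs : ℝ) (hρs : ρs ≠ 0)
    (hTs : T.mulVec s = ρs • s)
    (μ : Fin (n + 1) → ℝ) (hμ : ∀ i, μ i ≠ 0) (hsum : s = ∑ i, μ i • x i)
    (lam lam' : Fin (n + 1) → ℝ)
    (hlam : ∀ i, lam i ≠ 0) (hlam' : ∀ i, lam' i ≠ 0)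
    (hcol : ∀ i, s = lam i • x i + lam' i • y i) :
    ∀ i, ρ i * lam i / lam' i = ρ 0 * lam 0 / lam' 0 := by
  have hf : ∀ i, T.mulVecLin (x i) = (ρ i / lam' i) • s - (ρ i * lam i / lam' i) • x i := by
    intro i
    rw [mulVecLin_apply, hTx i, hcol i]
    have h := hlam' i
    match_scalars <;> field_simp
    ring
  have hk := hx.eq_sum_sub_of_map_eq_smul_sub_smul T.mulVecLin hTs hμ hsum hf
  exact fun i => (hk i).trans (hk 0).symm
end

section
/- (Existence of an n-dimensional eigenspace.) Under the hypotheses: T an invertible real (n+1)×(n+1) matrix, (x₁, …, x_{n+1}) a basis of ℝ^{n+1}, nonzero scalars ρᵢ with T·xᵢ = ρᵢ·yᵢ, a vector s with T·s = ρ_s·s (ρ_s ≠ 0), s = Σᵢ μᵢ·xᵢ with all μᵢ ≠ 0, and for every i scalars λᵢ ≠ 0, λ'ᵢ ≠ 0 with s = λᵢ·xᵢ + λ'ᵢ·yᵢ — set κ = −ρ₁·λ₁/λ'₁. Then for all i ≠ j the vector s_{ij} = λᵢ·xᵢ − λⱼ·xⱼ satisfies T·s_{ij} = κ·s_{ij},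 the span of {s_{ij} : i ≠ j} has dimension exactly n, and hence the eigenspace of T for the eigenvalue κ has dimension at least n; so T is a stereohomology (it possesses an eigenvalue whose eigenspace is a hyperplane). -/
open Matrix

/-- The span of the differences of distinct members of a family is its vector span. -/
theorem span_sub_ne_eq_vectorSpan {K V ι : Type*} [Ring K] [AddCommGroup V] [Module K V]
    (e : ι → V) :
    Submodule.span K {v : V | ∃ i j : ι, i ≠ j ∧ v = e i - e j} =
      vectorSpan K (Set.range e) := by
  apply le_antisymm
  · refine Submodule.span_mono ?_
    rintro v ⟨i, j, -, rfl⟩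
    exact Set.vsub_mem_vsub (Set.mem_range_self i) (Set.mem_range_self j)
  · refine Submodule.span_le.2 ?_
    rintro _ ⟨_, ⟨i, rfl⟩, _, ⟨j, rfl⟩, rfl⟩
    by_cases h : i = j
    · simp [h]
    · exact Submodule.subset_span ⟨i, j, h, rfl⟩

/-- If an endomorphism sends each member `x i` of a linearly independent family to
`a i • s + k i • x i`, and `s`, with nonzero coordinates in that family, is an eigenvector,
then all the `k i` agree. -/
theorem LinearIndependent.scalar_eq_of_map_eq_smul_add_smul {K V ι : Type*} [Field K]
    [AddCommGroup V] [Module K V] [Fintype ι] {x : ι → V} (hx : LinearIndependent K x)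
    {f : V →ₗ[K] V} {s : V} {a k μ : ι → K} {r : K} (hf : ∀ i, f (x i) = a i • s + k i • x i)
    (hs : f s = r • s) (hsum : s = ∑ i, μ i • x i) (hμ : ∀ i, μ i ≠ 0) (i j : ι) :
    k i = k j := by
  obtain ⟨c, hc⟩ : ∃ c, c = r - ∑ i, μ i * a i := ⟨_, rfl⟩
  have key : ∑ i, (μ i * k i - c * μ i) • x i = 0 := by
    have h₁ : f s = (∑ i, μ i * a i) • s + ∑ i, (μ i * k i) • x i := by
      conv_lhs => rw [hsum]
      simp only [map_sum, map_smul, hf, smul_add, smul_smul, Finset.sum_add_distrib,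
        Finset.sum_smul]
    have h₂ : ∑ i, (c * μ i) • x i = c • s := by
      rw [hsum, Finset.smul_sum]
      simp only [smul_smul]
    simp only [sub_smul, Finset.sum_sub_distrib]
    rw [h₂, hc, sub_smul, ← hs, h₁]
    abel
  have hk : ∀ i, k i = c := fun i => by
    have h := Fintype.linearIndependent_iff.1 hx _ key i
    apply mul_left_cancel₀ (hμ i)
    linear_combination h
  rw [hk i, hk j]



/-- Existence of an n-dimensional eigenspace: `T` is a
stereohomology, with eigenvalue `κ = −ρ₁·λ₁/λ'₁` whose eigenspace is a
hyperplane. -/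
theorem stmt_17 (n : ℕ) (hn : 1 ≤ n)
    (T : Matrix (Fin (n + 1)) (Fin (n + 1)) ℝ) (hT : IsUnit T.det)
    (x y : Fin (n + 1) → (Fin (n + 1) → ℝ)) (hx : LinearIndependent ℝ x)
    (ρ : Fin (n + 1) → ℝ) (hρ : ∀ i, ρ i ≠ 0)
    (hTx : ∀ i, T.mulVec (x i) = ρ i • y i)
    (s : Fin (n + 1) → ℝ) (ρs : ℝ) (hρs : ρs ≠ 0)
    (hTs : T.mulVec s = ρs • s)
    (μ : Fin (n + 1) → ℝ) (hμ : ∀ i, μ i ≠ 0) (hsum : s = ∑ i, μ i • x i)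
    (lam lam' : Fin (n + 1) → ℝ)
    (hlam : ∀ i, lam i ≠ 0) (hlam' : ∀ i, lam' i ≠ 0)
    (hcol : ∀ i, s = lam i • x i + lam' i • y i)
    (κ : ℝ) (hκ : κ = -(ρ 0 * lam 0 / lam' 0)) :
    (∀ i j, i ≠ j →
      T.mulVec (lam i • x i - lam j • x j) = κ • (lam i • x i - lam j • x j)) ∧
    Module.finrank ℝ (Submodule.span ℝ
      {v : Fin (n + 1) → ℝ |
        ∃ i j : Fin (n + 1), i ≠ j ∧ v = lam i • x i - lam j • x j}) = n ∧
    n ≤ Module.finrank ℝ (Module.End.eigenspace T.mulVecLin κ) := by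
  have hf : ∀ i, T.mulVecLin (x i) =
      (ρ i / lam' i) • s + (-(ρ i * lam i / lam' i)) • x i := fun i => by
    rw [mulVecLin_apply, hTx, hcol i, smul_add, smul_smul, smul_smul,
      div_mul_cancel₀ _ (hlam' i)]
    module
  have hκi : ∀ i, -(ρ i * lam i / lam' i) = κ := fun i => by
    rw [hκ]
    exact hx.scalar_eq_of_map_eq_smul_add_smul hf (r := ρs) (by simpa using hTs) hsum hμ i 0
  have hdiff : ∀ i j, T.mulVec (lam i • x i - lam j • x j) =
      κ • (lam i • x i - lam j • x j) := fun i j => by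
    have h : ∀ i, T.mulVec (lam i • x i) = (-κ) • s + κ • lam i • x i := fun i => by
      have hi := hf i
      rw [hκi i, mulVecLin_apply] at hi
      rw [mulVec_smul, hi, ← hκi i]
      module
    rw [mulVec_sub, h i, h j]
    module
  have hspan : Module.finrank ℝ (Submodule.span ℝ
      {v : Fin (n + 1) → ℝ |
        ∃ i j : Fin (n + 1), i ≠ j ∧ v = lam i • x i - lam j • x j}) = n := by
    have he : LinearIndependent ℝ fun i => lam i • x i :=
      hx.units_smul fun i => Units.mk0 (lam i) (hlam i)
    rw [span_sub_ne_eq_vectorSpan fun i => lam i • x i]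
    exact he.affineIndependent.finrank_vectorSpan (by simp)
  refine ⟨fun i j _ => hdiff i j, hspan, ?_⟩
  calc
    n = _ := hspan.symm
    _ ≤ _ := Submodule.finrank_mono (Submodule.span_le.2 ?_)
  rintro v ⟨i, j, -, rfl⟩
  exact Module.End.mem_eigenspace_iff.2 (hdiff i j)
end
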